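/- arXiv:1412.5308 — 2 statements merged into one kernel-verified Lean document; each statement's English description precedes it below -/
import Mathlib

section
/- Given a specialization (Γ, p) ⇝ (Γ', p') of enriched graphs, the map E(Γ')_{p'} → E(Γ)_p that sends each class [e']_{p'} to the class [e]_p of the minimal edge e with respect to p among the edges e ∈ E(Γ') with e ∼_{p'} e' is well defined and injective. -/
/-- A finite multigraph: finitely many vertices and edges, each edge has two
(ordered, possibly equal) endpoints; loops and multiple edges are allowed. -/
structure Multigraph where
  V : Type
  E : Type
  [finV : Finite V]
  [finE : Finite E]
  fst : E → V
  snd : E → V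

attribute [instance] Multigraph.finV Multigraph.finE

namespace Multigraph

variable (Γ : Multigraph)

/-- `v` is an endpoint of the edge `e`. -/
def Inc (v : Γ.V) (e : Γ.E) : Prop := Γ.fst e = v ∨ Γ.snd e = v

/-- `e` is a loop. -/
def IsLoop (e : Γ.E) : Prop := Γ.fst e = Γ.snd e

/-- Adjacency inside the induced subgraph on the vertex set `W`. -/
def AdjOn (W : Set Γ.V) (a b : Γ.V) : Prop :=
  a ∈ W ∧ b ∈ W ∧ ∃ e : Γ.E, (Γ.fst e = a ∧ Γ.snd e = b) ∨ (Γ.fst e = b ∧ Γ.snd e = a)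

/-- The induced subgraph on `W` is (nonempty and) connected. -/
def ConnectedOn (W : Set Γ.V) : Prop :=
  W.Nonempty ∧ ∀ a ∈ W, ∀ b ∈ W, Relation.ReflTransGen (Γ.AdjOn W) a b

/-- `Γ` is connected. -/
def Connected : Prop := Γ.ConnectedOn Set.univ

/-- A separating vertex: its removal disconnects the graph; moreover a vertex
carrying a loop is separating provided at least one other edge is attached to it. -/
def SeparatingVertex (v : Γ.V) : Prop :=
  ({w : Γ.V | w ≠ v}.Nonempty ∧ ¬ Γ.ConnectedOn {w : Γ.V | w ≠ v}) ∨
  (∃ e₁ e₂ : Γ.E, e₁ ≠ e₂ ∧ Γ.IsLoop e₁ ∧ Γ.Inc v e₁ ∧ Γ.Inc v e₂)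

/-- `Γ` is biconnected: connected and without separating vertices. -/
def Biconnected : Prop := Γ.Connected ∧ ∀ v : Γ.V, ¬ Γ.SeparatingVertex v

/-- The set `E(W, Wᶜ)` of edges joining a vertex of `W` to a vertex outside `W` (a *cut*). -/
def crossEdges (W : Set Γ.V) : Set Γ.E :=
  {e | (Γ.fst e ∈ W ∧ Γ.snd e ∉ W) ∨ (Γ.snd e ∈ W ∧ Γ.fst e ∉ W)}

/-- `W` determines a bond: a nontrivial partition `W ∪ Wᶜ` with both induced subgraphs
connected. -/
def IsBondOn (W : Set Γ.V) : Prop :=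
  W.Nonempty ∧ Wᶜ.Nonempty ∧ Γ.ConnectedOn W ∧ Γ.ConnectedOn Wᶜ

/-- A bond: a minimal cut. -/
def IsBond (B : Set Γ.E) : Prop := ∃ W : Set Γ.V, Γ.IsBondOn W ∧ B = Γ.crossEdges W

/-- The subgraph consisting of the edges in `F` together with their endpoints. -/
def edgeSubgraph (F : Set Γ.E) : Multigraph where
  V := {v : Γ.V // ∃ e ∈ F, Γ.Inc v e}
  E := {e : Γ.E // e ∈ F}
  fst := fun e => ⟨Γ.fst e.1, e.1, e.2, Or.inl rfl⟩
  snd := fun e => ⟨Γ.snd e.1, e.1, e.2, Or.inr rfl⟩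

/-- A biconnected component: a maximal set of edges inducing a biconnected subgraph. -/
def IsBicomponent (F : Set Γ.E) : Prop :=
  (Γ.edgeSubgraph F).Biconnected ∧
    ∀ F' : Set Γ.E, F ⊆ F' → (Γ.edgeSubgraph F').Biconnected → F' = F

/-- The contraction `Γ/S` of `Γ`: all the edges in `S` are contracted; the remaining
edges are `E(Γ) \ S`. -/
def contract (S : Set Γ.E) : Multigraph where
  V := Quot (fun a b : Γ.V => ∃ e ∈ S, Γ.fst e = a ∧ Γ.snd e = b)
  E := {e : Γ.E // e ∉ S}
  fst := fun e => Quot.mk _ (Γ.fst e.1)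
  snd := fun e => Quot.mk _ (Γ.snd e.1)

/-- Enriched graphs (Abreu–Pacini): `p` is an enriched structure on `Γ`, i.e. a
preorder on the edges satisfying the recursive conditions (1), (2), (3). -/
inductive IsEnriched : ∀ G : Multigraph, (G.E → G.E → Prop) → Prop
  | of_subsingleton (G : Multigraph) (p : G.E → G.E → Prop)
      (hrefl : Reflexive p) (htrans : Transitive p) (hsub : Subsingleton G.E) :
      IsEnriched G p
  | of_biconnected (G : Multigraph) (p : G.E → G.E → Prop)
      (hrefl : Reflexive p) (htrans : Transitive p)
      (hbic : G.Biconnected) (S : Set G.E) (hne : S.Nonempty)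
      (hlow : ∀ e e' : G.E, p e e' → e' ∈ S → e ∈ S)
      (hmin : ∀ e ∈ S, ∀ e' : G.E, p e e')
      (hrec : IsEnriched (G.contract S) (fun a b => p a.1 b.1)) :
      IsEnriched G p
  | of_separating (G : Multigraph) (p : G.E → G.E → Prop)
      (hrefl : Reflexive p) (htrans : Transitive p)
      (hsep : ∃ v : G.V, G.SeparatingVertex v)
      (hcomp : ∀ F : Set G.E, G.IsBicomponent F →
        IsEnriched (G.edgeSubgraph F) (fun a b => p a.1 b.1))
      (hincomp : ∀ F F' : Set G.E, G.IsBicomponent F → G.IsBicomponent F' → F ≠ F' →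
        ∀ e ∈ F, ∀ e' ∈ F', ¬ p e e') :
      IsEnriched G p

/-- `a ∼ₚ b`. -/
def Esim (p : Γ.E → Γ.E → Prop) (a b : Γ.E) : Prop := p a b ∧ p b a

/-- `a <ₚ b`. -/
def StrictBelow (p : Γ.E → Γ.E → Prop) (a b : Γ.E) : Prop := p a b ∧ ¬ p b a

/-- The classes of `a` and `b` are consecutive (with `a` below `b`). -/
def Consecutive (p : Γ.E → Γ.E → Prop) (a b : Γ.E) : Prop :=
  StrictBelow Γ p a b ∧ ∀ c : Γ.E, ¬ (StrictBelow Γ p a c ∧ StrictBelow Γ p c b)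

/-- The specialization `(Γ, p) ⇝ (Γ, p')` (same underlying graph, `S = ∅`). -/
def SpecializesSame (p p' : Γ.E → Γ.E → Prop) : Prop :=
  IsEnriched Γ p ∧ IsEnriched Γ p' ∧ ∀ e e' : Γ.E, p e e' → p' e e'

/-- The specialization `(Γ, p) ⇝ (Γ/S, p')`. -/
def Specializes (p : Γ.E → Γ.E → Prop) (S : Set Γ.E)
    (p' : (Γ.contract S).E → (Γ.contract S).E → Prop) : Prop :=
  IsEnriched Γ p ∧ IsEnriched (Γ.contract S) p' ∧
  (∀ e e' : Γ.E, p e e' → e' ∈ S → e ∈ S) ∧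
  (∀ (e e' : Γ.E) (he : e ∉ S) (he' : e' ∉ S), p e e' → p' ⟨e, he⟩ ⟨e', he'⟩)

/-- A simple specialization `(Γ, p) ⇝ (Γ, p')`: it merges two consecutive classes. -/
def IsSimpleSpec (p p' : Γ.E → Γ.E → Prop) : Prop :=
  SpecializesSame Γ p p' ∧ ∃ e₁ e₂ : Γ.E, Consecutive Γ p e₁ e₂ ∧
    ∀ e e' : Γ.E, p' e e' ↔ p e e' ∨
      ((Esim Γ p e e₁ ∨ Esim Γ p e e₂) ∧ (Esim Γ p e' e₁ ∨ Esim Γ p e' e₂))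

/-- `rank(p)`: the number of equivalence classes of edges. -/
noncomputable def rank (p : Γ.E → Γ.E → Prop) : ℕ := Nat.card (Quot (Esim Γ p))

/-- The (relatively open) cone `K(Γ, p) ⊆ ℝ^{E(Γ)}`. -/
def K (p : Γ.E → Γ.E → Prop) : Set (Γ.E → ℝ) :=
  {x | (∀ e, 0 < x e) ∧ ∀ e e' : Γ.E, p e e' → x e ≤ x e' ∧ (x e = x e' ↔ p e' e)}

open Classical in
/-- The injective linear map `ī : ℝ^{E(Γ/S)} → ℝ^{E(Γ)}` (extension by zero). -/
noncomputable def extendZero (S : Set Γ.E) (y : (Γ.contract S).E → ℝ) : Γ.E → ℝ :=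
  fun e => if h : e ∈ S then 0 else y ⟨e, h⟩

end Multigraph

/-- A face of a closed convex cone `σ`: either `σ` itself, or `σ ∩ ker ℓ` for a linear
functional `ℓ` which is nonnegative on `σ`. -/
def IsFaceOf {α : Type} (σ F : Set (α → ℝ)) : Prop :=
  F = σ ∨ ∃ ℓ : (α → ℝ) →ₗ[ℝ] ℝ, (∀ x ∈ σ, 0 ≤ ℓ x) ∧ F = σ ∩ {x | ℓ x = 0}

namespace Multigraph

/-- `B` is a minimal nonempty cut. -/
def IsMinCut (G : Multigraph) (B : Set G.E) : Prop :=
  (∃ U, B = G.crossEdges U) ∧ B.Nonempty ∧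
    ∀ U, G.crossEdges U ⊆ B → (G.crossEdges U).Nonempty → G.crossEdges U = B

/-- `r` is a retraction onto the vertices of `F` that is constant along the edges outside `F`. -/
def IsRetraction (G : Multigraph) (F : Set G.E) (r : G.V → G.V) : Prop :=
  (∀ e ∈ F, r (G.fst e) = G.fst e ∧ r (G.snd e) = G.snd e) ∧
    ∀ e ∉ F, r (G.fst e) = r (G.snd e)

theorem crossEdges_compl (G : Multigraph) (U : Set G.V) :
    G.crossEdges Uᶜ = G.crossEdges U := by
  ext e
  simp only [crossEdges, Set.mem_ofPred_eq, Set.mem_compl_iff]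
  tauto

theorem ConnectedOn.subset_of_closed {G : Multigraph} {W K : Set G.V} (h : G.ConnectedOn W)
    {a : G.V} (ha : a ∈ W) (haK : a ∈ K)
    (h₁ : ∀ g, G.fst g ∈ W → G.snd g ∈ W → (G.fst g ∈ K ↔ G.snd g ∈ K)) : W ⊆ K := by
  intro b hb
  have hr := h.2 a ha b hb
  clear hb
  induction hr with
  | refl => exact haK
  | tail _ hbc ih =>
    obtain ⟨hb, hc, g, ⟨rfl, rfl⟩ | ⟨rfl, rfl⟩⟩ := hbc
    · exact (h₁ g hb hc).1 ih
    · exact (h₁ g hc hb).2 ih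

theorem exists_closed_of_not_connectedOn {G : Multigraph} {W : Set G.V} (hne : W.Nonempty)
    (h : ¬ G.ConnectedOn W) : ∃ K ⊆ W, ∃ a ∈ K, ∃ b ∈ W, b ∉ K ∧
      ∀ g, G.fst g ∈ W → G.snd g ∈ W → (G.fst g ∈ K ↔ G.snd g ∈ K) := by
  simp only [ConnectedOn, not_and, not_forall] at h
  obtain ⟨a, ha, b, hb, hab⟩ := h hne
  refine ⟨{x | x ∈ W ∧ Relation.ReflTransGen (G.AdjOn W) a x}, fun x hx => hx.1, a,
    ⟨ha, .refl⟩, b, hb, fun hx => hab hx.2, fun g h₁ h₂ => ⟨fun hx => ⟨h₂, ?_⟩,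
      fun hx => ⟨h₁, ?_⟩⟩⟩
  · exact hx.2.tail ⟨h₁, h₂, g, .inl ⟨rfl, rfl⟩⟩
  · exact hx.2.tail ⟨h₂, h₁, g, .inr ⟨rfl, rfl⟩⟩

theorem Biconnected.not_isLoop {G : Multigraph} (hG : G.Biconnected) {l g : G.E} (hgl : l ≠ g) :
    ¬ G.IsLoop l := by
  intro hl
  have key : ∀ h, G.Inc (G.fst l) h → l = h := fun h hi => by
    by_contra hne
    exact hG.2 (G.fst l) (.inr ⟨l, h, hne, hl, .inl rfl, hi⟩)
  have hall := hG.1.subset_of_closed (K := {G.fst l}) (Set.mem_univ (G.fst l)) rfl (by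
    intro h _ _
    simp only [Set.mem_singleton_iff]
    constructor
    · intro hf
      obtain rfl := key h (.inl hf)
      exact hl.symm
    · intro hf
      obtain rfl := key h (.inr hf)
      rfl)
  exact hgl (key g (.inl (hall (Set.mem_univ _))))

theorem Biconnected.connectedOn_ne {G : Multigraph} (hG : G.Biconnected) (v : G.V)
    (hne : {w : G.V | w ≠ v}.Nonempty) : G.ConnectedOn {w : G.V | w ≠ v} := by
  by_contra h
  exact hG.2 v (.inl ⟨hne, h⟩)

theorem Biconnected.isMinCut_star {G : Multigraph} (hG : G.Biconnected) (v : G.V)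
    (hne : (G.crossEdges {v}).Nonempty) : G.IsMinCut (G.crossEdges {v}) := by
  have key : ∀ U, v ∉ U → G.crossEdges U ⊆ G.crossEdges {v} → (G.crossEdges U).Nonempty →
      G.crossEdges U = G.crossEdges {v} := by
    intro U hv hsub hUne
    have ⟨u, hu⟩ : U.Nonempty := by
      obtain ⟨e, he | he⟩ := hUne
      exacts [⟨_, he.1⟩, ⟨_, he.1⟩]
    have huv : u ≠ v := by rintro rfl; exact hv hu
    have hall := (hG.connectedOn_ne v ⟨u, huv⟩).subset_of_closed (K := U) huv hu (by
      intro g h₁ h₂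
      by_contra hg
      have : g ∈ G.crossEdges U := by
        simp only [crossEdges, Set.mem_ofPred_eq]
        tauto
      rcases hsub this with h | h
      exacts [h₁ h.1, h₂ h.1])
    have : U = {v}ᶜ := Set.Subset.antisymm (fun x hx => by rintro rfl; exact hv hx)
      (fun x hx => hall hx)
    rw [this, crossEdges_compl]
  refine ⟨⟨_, rfl⟩, hne, fun U hsub hUne => ?_⟩
  by_cases hv : v ∈ U
  · rw [← crossEdges_compl] at hsub hUne ⊢
    exact key _ (fun h => h hv) hsub hUne
  · exact key U hv hsub hUne

/-- In a biconnected graph with at least two edges, a set of edges closed under sharing a minimal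
cut contains all edges as soon as it contains one. -/
theorem Biconnected.mem_of_closed {G : Multigraph} (hG : G.Biconnected) {e e' : G.E}
    (R : Set G.E) (he : e ∈ R)
    (hR : ∀ B, G.IsMinCut B → ∀ a ∈ B, ∀ b ∈ B, a ∈ R → b ∈ R) : e' ∈ R := by
  by_cases hee : e = e'
  · exact hee ▸ he
  have hloop : ∀ g, ¬ G.IsLoop g := fun g => by
    by_cases hg : g = e
    · exact hG.not_isLoop (g := e') (hg ▸ hee)
    · exact hG.not_isLoop hg
  have hcross : ∀ v g, G.Inc v g → g ∈ G.crossEdges {v} := by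
    rintro v g (rfl | rfl)
    · exact .inl ⟨rfl, fun h => hloop g h.symm⟩
    · exact .inr ⟨rfl, fun h => hloop g h⟩
  have hstep : ∀ v f g, f ∈ R → G.Inc v f → G.Inc v g → g ∈ R := fun v f g hf hvf hvg =>
    hR _ (hG.isMinCut_star v ⟨f, hcross v f hvf⟩) f (hcross v f hvf) g (hcross v g hvg) hf
  have hall := hG.1.subset_of_closed (K := {v | ∃ f ∈ R, G.Inc v f}) (Set.mem_univ (G.fst e))
    ⟨e, he, .inl rfl⟩ (by
      intro g _ _
      constructor
      · rintro ⟨f, hf, hi⟩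
        exact ⟨g, hstep _ f g hf hi (.inl rfl), .inr rfl⟩
      · rintro ⟨f, hf, hi⟩
        exact ⟨g, hstep _ f g hf hi (.inr rfl), .inl rfl⟩)
  obtain ⟨f, hf, hi⟩ := hall (Set.mem_univ (G.fst e'))
  exact hstep _ f e' hf hi (.inl rfl)

section Transfer

variable {G H : Multigraph} {φ : H.E → G.E}

theorem IsMinCut.image (hφ : Function.Injective φ)
    (himg : ∀ W, ∃ U, G.crossEdges U = φ '' H.crossEdges W)
    (hpre : ∀ U, G.crossEdges U ⊆ Set.range φ → ∃ W, H.crossEdges W = φ ⁻¹' G.crossEdges U)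
    {B : Set H.E} (hB : H.IsMinCut B) : G.IsMinCut (φ '' B) := by
  obtain ⟨⟨W, rfl⟩, hne, hmin⟩ := hB
  obtain ⟨U, hU⟩ := himg W
  refine ⟨⟨U, hU.symm⟩, hne.image φ, fun U' hsub hne' => ?_⟩
  have hrange := hsub.trans (Set.image_subset_range φ _)
  obtain ⟨W', hW'⟩ := hpre U' hrange
  have := hmin W' ?_ ?_
  · rw [← this, hW', Set.image_preimage_eq_of_subset hrange]
  · rw [hW', ← Set.preimage_image_eq (H.crossEdges W) hφ]
    exact Set.preimage_mono hsub
  · obtain ⟨x, hx⟩ := hne'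
    obtain ⟨y, rfl⟩ := hrange hx
    exact ⟨y, hW' ▸ hx⟩

theorem IsMinCut.preimage (hφ : Function.Injective φ)
    (himg : ∀ W, ∃ U, G.crossEdges U = φ '' H.crossEdges W)
    (hpre : ∀ U, G.crossEdges U ⊆ Set.range φ → ∃ W, H.crossEdges W = φ ⁻¹' G.crossEdges U)
    {B : Set G.E} (hB : G.IsMinCut B) (hrange : B ⊆ Set.range φ) : H.IsMinCut (φ ⁻¹' B) := by
  obtain ⟨⟨U, rfl⟩, hne, hmin⟩ := hB
  obtain ⟨W, hW⟩ := hpre U hrange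
  refine ⟨⟨W, hW.symm⟩, ?_, fun W' hsub hne' => ?_⟩
  · obtain ⟨x, hx⟩ := hne
    obtain ⟨y, rfl⟩ := hrange hx
    exact ⟨y, hx⟩
  · obtain ⟨U', hU'⟩ := himg W'
    have := hmin U' (by rw [hU']; exact Set.image_subset_iff.2 hsub)
      (by rw [hU']; exact hne'.image φ)
    rw [← this, hU', Set.preimage_image_eq _ hφ]

end Transfer

theorem crossEdges_eq_image_contract (G : Multigraph) (S : Set G.E)
    (W : Set (G.contract S).V) : ∃ U, G.crossEdges U =
      (Subtype.val : (G.contract S).E → G.E) '' (G.contract S).crossEdges W := by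
  refine ⟨{v | Quot.mk _ v ∈ W}, ?_⟩
  ext g
  constructor
  · intro hg
    have hgS : g ∉ S := by
      intro hgS
      have : (Quot.mk _ (G.fst g) : (G.contract S).V) = Quot.mk _ (G.snd g) :=
        Quot.sound ⟨g, hgS, rfl, rfl⟩
      simp only [crossEdges, Set.mem_ofPred_eq] at hg
      rw [this] at hg
      tauto
    exact ⟨⟨g, hgS⟩, hg, rfl⟩
  · rintro ⟨g, hg, rfl⟩
    exact hg

theorem exists_crossEdges_contract_eq_preimage (G : Multigraph) (S : Set G.E) (U : Set G.V)
    (hU : G.crossEdges U ⊆ Set.range (Subtype.val : (G.contract S).E → G.E)) :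
    ∃ W, (G.contract S).crossEdges W =
      (Subtype.val : (G.contract S).E → G.E) ⁻¹' G.crossEdges U := by
  refine ⟨{q | Quot.lift (· ∈ U) ?_ q}, rfl⟩
  rintro _ _ ⟨g, hg, rfl, rfl⟩
  by_contra hne
  have : g ∈ G.crossEdges U := by
    simp only [crossEdges, Set.mem_ofPred_eq]
    simp only [eq_iff_iff] at hne
    tauto
  obtain ⟨g', rfl⟩ := hU this
  exact g'.2 hg

theorem IsRetraction.crossEdges_eq_image {G : Multigraph} {F : Set G.E} {r : G.V → G.V}
    (hr : G.IsRetraction F r) (W : Set (G.edgeSubgraph F).V) : ∃ U, G.crossEdges U =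
      (Subtype.val : (G.edgeSubgraph F).E → G.E) '' (G.edgeSubgraph F).crossEdges W := by
  refine ⟨{v | r v ∈ (Subtype.val : (G.edgeSubgraph F).V → G.V) '' W}, ?_⟩
  have hmem : ∀ x : (G.edgeSubgraph F).V,
      x.1 ∈ (Subtype.val : (G.edgeSubgraph F).V → G.V) '' W ↔ x ∈ W :=
    fun x => Subtype.val_injective.mem_set_image
  have hmem' : ∀ g : (G.edgeSubgraph F).E, g.1 ∈ G.crossEdges
      {v | r v ∈ (Subtype.val : (G.edgeSubgraph F).V → G.V) '' W} ↔
      g ∈ (G.edgeSubgraph F).crossEdges W := by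
    intro g
    simp only [crossEdges, Set.mem_ofPred_eq, (hr.1 g.1 g.2).1, (hr.1 g.1 g.2).2]
    rw [← hmem ((G.edgeSubgraph F).fst g), ← hmem ((G.edgeSubgraph F).snd g)]
    rfl
  ext g
  constructor
  · intro hg
    have hgF : g ∈ F := by
      by_contra hgF
      simp only [crossEdges, Set.mem_ofPred_eq, hr.2 g hgF] at hg
      tauto
    exact ⟨⟨g, hgF⟩, (hmem' ⟨g, hgF⟩).1 hg, rfl⟩
  · rintro ⟨g, hg, rfl⟩
    exact (hmem' g).2 hg

theorem crossEdges_edgeSubgraph (G : Multigraph) (F : Set G.E) (U : Set G.V) :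
    (G.edgeSubgraph F).crossEdges (Subtype.val ⁻¹' U) =
      (Subtype.val : (G.edgeSubgraph F).E → G.E) ⁻¹' G.crossEdges U := rfl

theorem IsMinCut.subset_of_isRetraction {G : Multigraph} {F : Set G.E} {r : G.V → G.V}
    (hr : G.IsRetraction F r) {B : Set G.E} (hB : G.IsMinCut B) {e : G.E} (heB : e ∈ B)
    (heF : e ∈ F) : B ⊆ F := by
  obtain ⟨⟨U, rfl⟩, hne, hmin⟩ := hB
  obtain ⟨U', hU'⟩ := hr.crossEdges_eq_image (Subtype.val ⁻¹' U)
  rw [crossEdges_edgeSubgraph] at hU'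
  rw [← hmin U' (by rw [hU']; exact Set.image_preimage_subset _ _)
    (by rw [hU']; exact ⟨e, ⟨e, heF⟩, heB, rfl⟩), hU']
  rintro _ ⟨g, _, rfl⟩
  exact g.2

theorem IsRetraction.comp {G : Multigraph} {F F₁ : Set G.E} {r r₁ : G.V → G.V}
    (hr : G.IsRetraction F r) (hsub : F₁ ⊆ F)
    (h₁ : ∀ e ∈ F₁, r₁ (G.fst e) = G.fst e ∧ r₁ (G.snd e) = G.snd e)
    (h₂ : ∀ e ∈ F, e ∉ F₁ → r₁ (G.fst e) = r₁ (G.snd e)) :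
    G.IsRetraction F₁ (r₁ ∘ r) := by
  refine ⟨fun e he => ?_, fun e he => ?_⟩
  · simpa [(hr.1 e (hsub he)).1, (hr.1 e (hsub he)).2] using h₁ e he
  · by_cases heF : e ∈ F
    · simpa [(hr.1 e heF).1, (hr.1 e heF).2] using h₂ e heF he
    · simp [hr.2 e heF]

/-- A minimal edge set containing `e` that admits a retraction cannot be split at a vertex. -/
theorem touch_all_or_none {G : Multigraph} {F : Set G.E} {r : G.V → G.V} {e : G.E}
    (hr : G.IsRetraction F r) (he : e ∈ F)
    (hmin : ∀ F₁ ⊆ F, e ∈ F₁ → (∃ r₁, G.IsRetraction F₁ r₁) → F₁ = F)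
    (K : Set G.V) (v : G.V)
    (hK : ∀ g ∈ F, G.fst g ∈ K ∨ G.snd g ∈ K →
      (G.fst g ∈ K ∨ G.fst g = v) ∧ (G.snd g ∈ K ∨ G.snd g = v)) :
    (∀ g ∈ F, G.fst g ∈ K ∨ G.snd g ∈ K) ∨ ∀ g ∈ F, G.fst g ∉ K ∧ G.snd g ∉ K := by
  classical
  by_cases heK : G.fst e ∈ K ∨ G.snd e ∈ K
  · left
    have := hmin {g ∈ F | G.fst g ∈ K ∨ G.snd g ∈ K} (fun g hg => hg.1) ⟨he, heK⟩
      ⟨_, hr.comp (r₁ := fun w => if w ∈ K then w else v) (fun g hg => hg.1) ?_ ?_⟩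
    · intro g hg
      rw [← this] at hg
      exact hg.2
    · rintro g ⟨hg, hgK⟩
      obtain ⟨h₁, h₂⟩ := hK g hg hgK
      constructor
      · rcases h₁ with h | h <;> simp [h]
      · rcases h₂ with h | h <;> simp [h]
    · intro g hg hg'
      have h₁ : G.fst g ∉ K := fun h => hg' ⟨hg, .inl h⟩
      have h₂ : G.snd g ∉ K := fun h => hg' ⟨hg, .inr h⟩
      simp [h₁, h₂]
  · right
    have := hmin {g ∈ F | G.fst g ∉ K ∧ G.snd g ∉ K} (fun g hg => hg.1) ⟨he, not_or.1 heK⟩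
      ⟨_, hr.comp (r₁ := fun w => if w ∈ K then v else w) (fun g hg => hg.1) ?_ ?_⟩
    · intro g hg
      rw [← this] at hg
      exact hg.2
    · rintro g ⟨hg, h₁, h₂⟩
      simp [h₁, h₂]
    · intro g hg hg'
      have hgK : G.fst g ∈ K ∨ G.snd g ∈ K := by
        by_contra h
        exact hg' ⟨hg, not_or.1 h⟩
      obtain ⟨h₁, h₂⟩ := hK g hg hgK
      rcases h₁ with h₁ | h₁ <;> rcases h₂ with h₂ | h₂ <;> simp [h₁, h₂]

theorem connectedOn_edgeSubgraph_of_minimal {G : Multigraph} {F : Set G.E} {r : G.V → G.V}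
    {e : G.E} (hr : G.IsRetraction F r) (he : e ∈ F)
    (hmin : ∀ F₁ ⊆ F, e ∈ F₁ → (∃ r₁, G.IsRetraction F₁ r₁) → F₁ = F)
    (W : Set (G.edgeSubgraph F).V) (hne : W.Nonempty) (hW : Wᶜ.Subsingleton) :
    (G.edgeSubgraph F).ConnectedOn W := by
  by_contra hcon
  obtain ⟨K, hKW, a, haK, b, hbW, hbK, hcl⟩ := exists_closed_of_not_connectedOn hne hcon
  -- the vertex at which `F` is split: the one outside `W`, if there is one
  obtain ⟨v, hvW⟩ : ∃ v, ∀ x ∉ W, x = v := by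
    by_cases h : ∃ v, v ∉ W
    · obtain ⟨v, hv⟩ := h
      exact ⟨v, fun x hx => hW hx hv⟩
    · push Not at h
      exact ⟨b, fun x hx => absurd (h x) hx⟩
  have hmem : ∀ x : (G.edgeSubgraph F).V,
      x.1 ∈ (Subtype.val : (G.edgeSubgraph F).V → G.V) '' K ↔ x ∈ K :=
    fun x => Subtype.val_injective.mem_set_image
  have hf : ∀ g (hg : g ∈ F), G.fst g ∈ (Subtype.val : (G.edgeSubgraph F).V → G.V) '' K ↔
      (G.edgeSubgraph F).fst ⟨g, hg⟩ ∈ K := fun g hg => hmem ((G.edgeSubgraph F).fst ⟨g, hg⟩)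
  have hs : ∀ g (hg : g ∈ F), G.snd g ∈ (Subtype.val : (G.edgeSubgraph F).V → G.V) '' K ↔
      (G.edgeSubgraph F).snd ⟨g, hg⟩ ∈ K := fun g hg => hmem ((G.edgeSubgraph F).snd ⟨g, hg⟩)
  rcases touch_all_or_none hr he hmin (Subtype.val '' K) v.1 (by
      intro g hg hgK
      rw [hf g hg, hs g hg] at hgK ⊢
      have h := hcl ⟨g, hg⟩
      have h₁ : (G.edgeSubgraph F).fst ⟨g, hg⟩ ∉ W → G.fst g = v.1 :=
        fun h => congrArg Subtype.val (hvW _ h)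
      have h₂ : (G.edgeSubgraph F).snd ⟨g, hg⟩ ∉ W → G.snd g = v.1 :=
        fun h => congrArg Subtype.val (hvW _ h)
      have h₃ := @hKW ((G.edgeSubgraph F).fst ⟨g, hg⟩)
      have h₄ := @hKW ((G.edgeSubgraph F).snd ⟨g, hg⟩)
      tauto) with hall | hnone
  · obtain ⟨b, g, hg, hbg⟩ := b
    have h := hcl ⟨g, hg⟩
    have h₃ := @hKW ((G.edgeSubgraph F).fst ⟨g, hg⟩)
    have h₄ := @hKW ((G.edgeSubgraph F).snd ⟨g, hg⟩)
    have hg' := hall g hg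
    rw [hf g hg, hs g hg] at hg'
    rcases hbg with rfl | rfl
    · change (G.edgeSubgraph F).fst ⟨g, hg⟩ ∈ W at hbW
      change (G.edgeSubgraph F).fst ⟨g, hg⟩ ∉ K at hbK
      tauto
    · change (G.edgeSubgraph F).snd ⟨g, hg⟩ ∈ W at hbW
      change (G.edgeSubgraph F).snd ⟨g, hg⟩ ∉ K at hbK
      tauto
  · obtain ⟨a, g, hg, hag⟩ := a
    have hg' := hnone g hg
    rw [hf g hg, hs g hg] at hg'
    rcases hag with rfl | rfl
    · exact hg'.1 haK
    · exact hg'.2 haK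

theorem biconnected_edgeSubgraph_of_minimal {G : Multigraph} {F : Set G.E} {r : G.V → G.V}
    {e : G.E} (hr : G.IsRetraction F r) (he : e ∈ F)
    (hmin : ∀ F₁ ⊆ F, e ∈ F₁ → (∃ r₁, G.IsRetraction F₁ r₁) → F₁ = F) :
    (G.edgeSubgraph F).Biconnected := by
  refine ⟨connectedOn_edgeSubgraph_of_minimal hr he hmin _ ⟨⟨G.fst e, e, he, .inl rfl⟩, trivial⟩
    (by simp), fun v hv => ?_⟩
  rcases hv with ⟨hne, hcon⟩ | ⟨e₁, e₂, hne, hl, -, -⟩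
  · refine hcon (connectedOn_edgeSubgraph_of_minimal hr he hmin _ hne ?_)
    intro x hx y hy
    simp only [Set.mem_compl_iff, Set.mem_ofPred_eq, not_not] at hx hy
    rw [hx, hy]
  · have hl' : G.fst e₁.1 = G.snd e₁.1 := congrArg Subtype.val hl
    by_cases hee : e = e₁.1
    · have := hmin {e} (by simpa using he) rfl ⟨fun _ => G.fst e, by
        rintro g rfl
        exact ⟨rfl, hee ▸ hl'⟩, fun _ _ => rfl⟩
      have h₂ : e₂.1 = e := this.symm.subset e₂.2
      exact hne (Subtype.ext (hee.symm.trans h₂.symm))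
    · have := hmin (F \ {e₁.1}) Set.sdiff_subset ⟨he, hee⟩ ⟨_, hr.comp (r₁ := id)
        Set.sdiff_subset (fun _ _ => ⟨rfl, rfl⟩) (fun g hg hg' => by
          have : g = e₁.1 := by
            by_contra h
            exact hg' ⟨hg, h⟩
          rw [this]
          exact hl')⟩
      exact (this.symm.subset e₁.2).2 rfl

theorem IsRetraction.isBicomponent {G : Multigraph} {F : Set G.E} {r : G.V → G.V}
    (hr : G.IsRetraction F r) (hF : (G.edgeSubgraph F).Biconnected) {e : G.E} (he : e ∈ F) :
    G.IsBicomponent F := by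
  refine ⟨hF, fun F' hsub hF' => ?_⟩
  by_contra hne
  obtain ⟨g, hg, hgF⟩ : ∃ g ∈ F', g ∉ F := by
    by_contra h
    push Not at h
    exact hne (Set.Subset.antisymm h hsub)
  have hge : (⟨g, hg⟩ : (G.edgeSubgraph F').E) ≠ ⟨e, hsub he⟩ := by
    intro h
    obtain rfl : g = e := congrArg Subtype.val h
    exact hgF he
  have hgl : G.fst g ≠ G.snd g := fun h => hF'.not_isLoop hge (Subtype.ext h)
  have hel : G.fst e ≠ G.snd e := fun h => hF'.not_isLoop hge.symm (Subtype.ext h)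
  obtain ⟨c, hc₁, hc₂⟩ : ∃ c, r (G.fst g) = c ∧ r (G.snd g) = c := ⟨_, rfl, (hr.2 g hgF).symm⟩
  obtain ⟨x, hxc, hrx⟩ : ∃ x : (G.edgeSubgraph F').V, x.1 ≠ c ∧ r x.1 = c := by
    by_cases h : G.fst g = c
    · exact ⟨(G.edgeSubgraph F').snd ⟨g, hg⟩, fun h' => hgl (h.trans h'.symm), hc₂⟩
    · exact ⟨(G.edgeSubgraph F').fst ⟨g, hg⟩, h, hc₁⟩
  obtain ⟨y, hyc, hry⟩ : ∃ y : (G.edgeSubgraph F').V, y.1 ≠ c ∧ r y.1 = y.1 := by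
    by_cases h : G.fst e = c
    · exact ⟨(G.edgeSubgraph F').snd ⟨e, hsub he⟩, fun h' => hel (h.trans h'.symm), (hr.1 e he).2⟩
    · exact ⟨(G.edgeSubgraph F').fst ⟨e, hsub he⟩, h, (hr.1 e he).1⟩
  have hconn : (G.edgeSubgraph F').ConnectedOn {w : (G.edgeSubgraph F').V | w.1 ≠ c} := by
    by_cases h : ∃ v : (G.edgeSubgraph F').V, v.1 = c
    · obtain ⟨v, rfl⟩ := h
      have hset : {w : (G.edgeSubgraph F').V | w.1 ≠ v.1} = {w | w ≠ v} := by
        ext w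
        exact not_congr Subtype.ext_iff.symm
      rw [hset]
      exact hF'.connectedOn_ne v ⟨x, fun h => hxc (congrArg Subtype.val h)⟩
    · push Not at h
      have hset : {w : (G.edgeSubgraph F').V | w.1 ≠ c} = Set.univ := Set.eq_univ_of_forall h
      rw [hset]
      exact hF'.1
  have hall := hconn.subset_of_closed (K := {w : (G.edgeSubgraph F').V | r w.1 = c}) (a := x) hxc hrx (by
    rintro ⟨k, hk⟩ h₁ h₂
    change G.fst k ≠ c at h₁
    change G.snd k ≠ c at h₂
    change r (G.fst k) = c ↔ r (G.snd k) = c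
    by_cases hkF : k ∈ F
    · rw [(hr.1 k hkF).1, (hr.1 k hkF).2]
      exact iff_of_false h₁ h₂
    · rw [hr.2 k hkF])
  have hy : r y.1 = c := hall hyc
  exact hyc (hry.symm.trans hy)

theorem exists_isBicomponent_isRetraction (G : Multigraph) (e : G.E) :
    ∃ F, e ∈ F ∧ G.IsBicomponent F ∧ ∃ r, G.IsRetraction F r := by
  obtain ⟨F, hF⟩ := (Set.toFinite {F : Set G.E | e ∈ F ∧ ∃ r, G.IsRetraction F r}).exists_minimal
    ⟨Set.univ, trivial, id, fun _ _ => ⟨rfl, rfl⟩, fun _ h => absurd trivial h⟩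
  obtain ⟨he, r, hr⟩ := hF.prop
  exact ⟨F, he, hr.isBicomponent (biconnected_edgeSubgraph_of_minimal hr he
    fun F₁ hsub he₁ hr₁ => hF.eq_of_subset ⟨he₁, hr₁⟩ hsub) he, r, hr⟩

namespace IsEnriched

variable {G : Multigraph} {p : G.E → G.E → Prop}

theorem refl (h : IsEnriched G p) (e : G.E) : p e e := by
  cases h <;> apply_assumption

theorem trans (h : IsEnriched G p) {a b c : G.E} (hab : p a b) (hbc : p b c) : p a c := by
  cases h <;> apply_assumption <;> assumption

theorem total_below (h : IsEnriched G p) :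
    ∀ {x y z : G.E}, p x z → p y z → p x y ∨ p y x := by
  induction h with
  | of_subsingleton G p hrefl htrans hsub =>
    intro x y z _ _
    rw [Subsingleton.elim x y]
    exact .inl (hrefl y)
  | of_biconnected G p hrefl htrans hbic S hne hlow hmin hrec ih =>
    intro x y z hx hy
    by_cases hxS : x ∈ S
    · exact .inl (hmin x hxS y)
    by_cases hyS : y ∈ S
    · exact .inr (hmin y hyS x)
    have hzS : z ∉ S := fun hz => hxS (hlow x z hx hz)
    exact ih (x := ⟨x, hxS⟩) (y := ⟨y, hyS⟩) (z := ⟨z, hzS⟩) hx hy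
  | of_separating G p hrefl htrans hsep hcomp hincomp ih =>
    intro x y z hx hy
    obtain ⟨F, hzF, hF, -⟩ := G.exists_isBicomponent_isRetraction z
    have key : ∀ w, p w z → w ∈ F := by
      intro w hw
      obtain ⟨F', hwF', hF', -⟩ := G.exists_isBicomponent_isRetraction w
      by_cases hFF : F' = F
      · exact hFF ▸ hwF'
      · exact absurd hw (hincomp F' F hF' hF hFF w hwF' z hzF)
    exact ih F hF (x := ⟨x, key x hx⟩) (y := ⟨y, key y hy⟩) (z := ⟨z, hzF⟩) hx hy

/-- Every minimal cut has a minimum for an enriched structure. -/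
theorem exists_min_of_isMinCut (h : IsEnriched G p) :
    ∀ {B : Set G.E}, G.IsMinCut B → ∃ m ∈ B, ∀ b ∈ B, p m b := by
  induction h with
  | of_subsingleton G p hrefl htrans hsub =>
    intro B hB
    obtain ⟨m, hm⟩ := hB.2.1
    refine ⟨m, hm, fun b _ => ?_⟩
    rw [Subsingleton.elim m b]
    exact hrefl b
  | of_biconnected G p hrefl htrans hbic S hne hlow hmin hrec ih =>
    intro B hB
    by_cases hBS : ∃ m ∈ B, m ∈ S
    · obtain ⟨m, hm, hmS⟩ := hBS
      exact ⟨m, hm, fun b _ => hmin m hmS b⟩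
    · push Not at hBS
      obtain ⟨m, hm, hmin'⟩ := ih (hB.preimage Subtype.val_injective
        (G.crossEdges_eq_image_contract S) (G.exists_crossEdges_contract_eq_preimage S)
        fun b hb => ⟨⟨b, hBS b hb⟩, rfl⟩)
      exact ⟨m.1, hm, fun b hb => hmin' ⟨b, hBS b hb⟩ hb⟩
  | of_separating G p hrefl htrans hsep hcomp hincomp ih =>
    intro B hB
    obtain ⟨e, he⟩ := hB.2.1
    obtain ⟨F, heF, hF, r, hr⟩ := G.exists_isBicomponent_isRetraction e
    have hBF := hB.subset_of_isRetraction hr he heF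
    obtain ⟨m, hm, hmin'⟩ := ih F hF (hB.preimage Subtype.val_injective
      hr.crossEdges_eq_image (fun U _ => ⟨_, G.crossEdges_edgeSubgraph F U⟩)
      fun b hb => ⟨⟨b, hBF hb⟩, rfl⟩)
    exact ⟨m.1, hm, fun b hb => hmin' ⟨b, hBF hb⟩ hb⟩

/-- If `e ≼ e'`, then `e'` is linked to `e` by minimal cuts consisting of edges above `e`. -/
theorem mem_of_closed (h : IsEnriched G p) : ∀ {e e' : G.E}, p e e' → ∀ R : Set G.E, e ∈ R →
    (∀ B, G.IsMinCut B → (∀ b ∈ B, p e b) → ∀ a ∈ B, ∀ b ∈ B, a ∈ R → b ∈ R) → e' ∈ R := by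
  induction h with
  | of_subsingleton G p hrefl htrans hsub =>
    intro e e' _ R he _
    rwa [Subsingleton.elim e' e]
  | of_biconnected G p hrefl htrans hbic S hne hlow hmin hrec ih =>
    intro e e' hee R he hR
    by_cases heS : e ∈ S
    · exact hbic.mem_of_closed R he fun B hB => hR B hB fun b _ => hmin e heS b
    · have heS' : e' ∉ S := fun h => heS (hlow e e' hee h)
      refine ih (e := ⟨e, heS⟩) (e' := ⟨e', heS'⟩) hee (Subtype.val ⁻¹' R) he ?_
      intro B hB hle a ha b hb haR
      refine hR _ (hB.image Subtype.val_injective (G.crossEdges_eq_image_contract S)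
        (G.exists_crossEdges_contract_eq_preimage S)) ?_ a.1 ⟨a, ha, rfl⟩ b.1 ⟨b, hb, rfl⟩ haR
      rintro _ ⟨c, hc, rfl⟩
      exact hle c hc
  | of_separating G p hrefl htrans hsep hcomp hincomp ih =>
    intro e e' hee R he hR
    obtain ⟨F, heF, hF, r, hr⟩ := G.exists_isBicomponent_isRetraction e
    have heF' : e' ∈ F := by
      obtain ⟨F', heF', hF', -⟩ := G.exists_isBicomponent_isRetraction e'
      by_cases hFF : F = F'
      · exact hFF ▸ heF'
      · exact absurd hee (hincomp F F' hF hF' hFF e heF e' heF')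
    refine ih F hF (e := ⟨e, heF⟩) (e' := ⟨e', heF'⟩) hee (Subtype.val ⁻¹' R) he ?_
    intro B hB hle a ha b hb haR
    refine hR _ (hB.image Subtype.val_injective hr.crossEdges_eq_image
      (fun U _ => ⟨_, G.crossEdges_edgeSubgraph F U⟩)) ?_ a.1 ⟨a, ha, rfl⟩ b.1 ⟨b, hb, rfl⟩ haR
    rintro _ ⟨c, hc, rfl⟩
    exact hle c hc

end IsEnriched

/-- Two edges with `e ≼_{p'} e'` have a common `p`-lower bound in the `p'`-class of `e`. -/
theorem Specializes.exists_common_lower_bound {Γ : Multigraph} {p : Γ.E → Γ.E → Prop}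
    {S : Set Γ.E} {p' : (Γ.contract S).E → (Γ.contract S).E → Prop}
    (h : Γ.Specializes p S p') {e e' : (Γ.contract S).E} (hee : p' e e') :
    ∃ n : (Γ.contract S).E, (p' n e ∧ p' e n) ∧ p n.1 e.1 ∧ p n.1 e'.1 := by
  obtain ⟨hp, hp', -, hspec⟩ := h
  obtain ⟨n, hen, hne, hne'⟩ := hp'.mem_of_closed hee
    {f | ∃ n : (Γ.contract S).E, p' e n ∧ p n.1 e.1 ∧ p n.1 f.1}
    ⟨e, hp'.refl e, hp.refl e.1, hp.refl e.1⟩ (by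
      rintro B hB hle a ha b hb ⟨n, hen, hne, hna⟩
      obtain ⟨_, ⟨m, hm, rfl⟩, hmin⟩ := hp.exists_min_of_isMinCut
        (hB.image Subtype.val_injective (Γ.crossEdges_eq_image_contract S)
          (Γ.exists_crossEdges_contract_eq_preimage S))
      have hma := hmin a.1 ⟨a, ha, rfl⟩
      have hmb := hmin b.1 ⟨b, hb, rfl⟩
      rcases hp.total_below hna hma with hnm | hmn
      · exact ⟨n, hen, hne, hp.trans hnm hmb⟩
      · exact ⟨m, hle m hm, hp.trans hmn hne, hmb⟩)
  exact ⟨n, ⟨hspec n.1 e.1 n.2 e.2 hne, hen⟩, hne, hne'⟩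

end Multigraph

/-- Corollary 3.11: given a specialization `(Γ, p) ⇝ (Γ/S, p')`,
every `p'`-class of an edge `e'` of `Γ/S` has a `p`-minimum element `m`, and sending
`[e']_{p'}` to `[m]_p` is a well-defined injective map `E(Γ/S)_{p'} → E(Γ)_p`. -/
theorem specialization_class_inclusion (Γ : Multigraph) (p : Γ.E → Γ.E → Prop)
    (S : Set Γ.E) (p' : (Γ.contract S).E → (Γ.contract S).E → Prop)
    (h : Multigraph.Specializes Γ p S p') :
    (∀ e' : (Γ.contract S).E, ∃ m : (Γ.contract S).E,
        (p' m e' ∧ p' e' m) ∧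
        ∀ f : (Γ.contract S).E, (p' f e' ∧ p' e' f) → p m.1 f.1) ∧
    (∀ e₁' e₂' m₁ m₂ : (Γ.contract S).E,
        ((p' m₁ e₁' ∧ p' e₁' m₁) ∧
          ∀ f : (Γ.contract S).E, (p' f e₁' ∧ p' e₁' f) → p m₁.1 f.1) →
        ((p' m₂ e₂' ∧ p' e₂' m₂) ∧
          ∀ f : (Γ.contract S).E, (p' f e₂' ∧ p' e₂' f) → p m₂.1 f.1) →
        (p m₁.1 m₂.1 ∧ p m₂.1 m₁.1) → (p' e₁' e₂' ∧ p' e₂' e₁')) := by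
  obtain ⟨hp, hp', -, hspec⟩ := id h
  refine ⟨fun e' => ?_, ?_⟩
  · have hdir : Directed (fun a b : Γ.E => p b a)
        (fun f : {f : (Γ.contract S).E // p' f e' ∧ p' e' f} => f.1.1) := by
      rintro ⟨x, hx₁, hx₂⟩ ⟨y, hy₁, hy₂⟩
      obtain ⟨n, ⟨hn₁, hn₂⟩, hnx, hny⟩ := h.exists_common_lower_bound (hp'.trans hx₁ hy₂)
      exact ⟨⟨n, hp'.trans hn₁ hx₁, hp'.trans hx₂ hn₂⟩, hnx, hny⟩
    have : IsTrans Γ.E (fun a b => p b a) := ⟨fun _ _ _ h₁ h₂ => hp.trans h₂ h₁⟩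
    have : Nonempty {f : (Γ.contract S).E // p' f e' ∧ p' e' f} :=
      ⟨⟨e', hp'.refl e', hp'.refl e'⟩⟩
    have : Finite {f : (Γ.contract S).E // p' f e' ∧ p' e' f} := inferInstance
    obtain ⟨m, hm⟩ := hdir.finite_le id
    exact ⟨m.1, m.2, fun f hf => hm ⟨f, hf⟩⟩
  · rintro e₁ e₂ m₁ m₂ ⟨⟨h₁, h₁'⟩, -⟩ ⟨⟨h₂, h₂'⟩, -⟩ ⟨h₃, h₄⟩
    have h₃' := hspec m₁.1 m₂.1 m₁.2 m₂.2 h₃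
    have h₄' := hspec m₂.1 m₁.1 m₂.2 m₁.2 h₄
    exact ⟨hp'.trans h₁' (hp'.trans h₃' h₂), hp'.trans h₂' (hp'.trans h₄' h₁)⟩
end

section
/- Let (Γ, p) be an enriched graph. For each irreducible upper set T ⊆ E(Γ) with respect to p, let v_T ∈ ℝ^{E(Γ)} be the vector v_T := Σ_{e∈T} e (the indicator vector of T). Then the closure of K(Γ, p) in ℝ^{E(Γ)} equals the set of all nonnegative real linear combinations of the vectors v_T, and the rays spanned by the vectors v_T are exactly the one-dimensional faces of this closed cone (i.e. the v_T are its ray generators). -/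
open Classical in
/-- The indicator vector `v_T ∈ ℝ^{E(Γ)}` of the irreducible upper set
`T = {e' | e ≼ₚ e'}`. -/
noncomputable def Multigraph.upInd (Γ : Multigraph) (p : Γ.E → Γ.E → Prop) (e : Γ.E) :
    Γ.E → ℝ :=
  fun e' => if p e e' then 1 else 0

namespace Multigraph

variable {Γ : Multigraph} {p : Γ.E → Γ.E → Prop}

theorem biconnected_edgeSubgraph_singleton (Γ : Multigraph) (e : Γ.E) :
    (Γ.edgeSubgraph {e}).Biconnected := by
  have hE : ∀ a b : (Γ.edgeSubgraph {e}).E, a = b := fun a b =>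
    Subtype.ext ((Set.mem_singleton_iff.1 a.2).trans (Set.mem_singleton_iff.1 b.2).symm)
  let e₀ : (Γ.edgeSubgraph {e}).E := ⟨e, rfl⟩
  have hV : ∀ v : (Γ.edgeSubgraph {e}).V,
      v = (Γ.edgeSubgraph {e}).fst e₀ ∨ v = (Γ.edgeSubgraph {e}).snd e₀ := by
    rintro ⟨v, f, hf, hv⟩
    obtain rfl : f = e := hf
    exact hv.imp (fun h => Subtype.ext h.symm) fun h => Subtype.ext h.symm
  refine ⟨⟨⟨(Γ.edgeSubgraph {e}).fst e₀, trivial⟩, fun a _ b _ => ?_⟩, fun v hv => ?_⟩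
  · rcases hV a with ha | ha <;> rcases hV b with hb | hb
    · rw [ha, hb]
    · exact .single ⟨trivial, trivial, e₀, Or.inl ⟨ha.symm, hb.symm⟩⟩
    · exact .single ⟨trivial, trivial, e₀, Or.inr ⟨hb.symm, ha.symm⟩⟩
    · rw [ha, hb]
  · rcases hv with ⟨hne, hcon⟩ | ⟨e₁, e₂, hne, -⟩
    · refine hcon ⟨hne, fun a (ha : a ≠ v) b (hb : b ≠ v) => ?_⟩
      have hab : a = b := by
        rcases hV a with h₁ | h₁ <;> rcases hV b with h₂ | h₂ <;> rcases hV v with h₃ | h₃ <;>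
          simp_all
      rw [hab]
    · exact hne (hE _ _)

theorem exists_isBicomponent_mem (Γ : Multigraph) (e : Γ.E) :
    ∃ F : Set Γ.E, Γ.IsBicomponent F ∧ e ∈ F := by
  obtain ⟨F, hF, hmax⟩ :=
    (Set.toFinite {F : Set Γ.E | (Γ.edgeSubgraph F).Biconnected}).exists_le_maximal
      (Γ.biconnected_edgeSubgraph_singleton e)
  exact ⟨F, ⟨hmax.prop, fun F' hF' hb => (hmax.eq_of_le hb hF').symm⟩, hF rfl⟩

theorem IsEnriched.refl_s16 (h : Γ.IsEnriched p) (e : Γ.E) : p e e := by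
  cases h <;> apply_assumption

theorem IsEnriched.trans_s16 (h : Γ.IsEnriched p) ⦃a b c : Γ.E⦄ (hab : p a b) (hbc : p b c) :
    p a c := by
  cases h with
  | of_subsingleton _ _ _ htrans => exact htrans hab hbc
  | of_biconnected _ _ _ htrans => exact htrans hab hbc
  | of_separating _ _ _ htrans => exact htrans hab hbc

/-- The lower set of every edge of an enriched graph is totally preordered. -/
theorem IsEnriched.comparable_of_le (h : Γ.IsEnriched p) ⦃a b c : Γ.E⦄
    (hac : p a c) (hbc : p b c) : p a b ∨ p b a := by
  induction h with
  | of_subsingleton G p hrefl htrans hsub =>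
    rw [Subsingleton.elim a b]
    exact Or.inl (hrefl b)
  | of_biconnected G p hrefl htrans hbic S hne hlow hmin hrec ih =>
    by_cases ha : a ∈ S
    · exact Or.inl (hmin a ha b)
    by_cases hb : b ∈ S
    · exact Or.inr (hmin b hb a)
    have hc : c ∉ S := fun hc => ha (hlow a c hac hc)
    exact ih (a := ⟨a, ha⟩) (b := ⟨b, hb⟩) (c := ⟨c, hc⟩) hac hbc
  | of_separating G p hrefl htrans hsep hcomp hincomp ih =>
    obtain ⟨F, hF, hc⟩ := G.exists_isBicomponent_mem c
    have hmem : ∀ d, p d c → d ∈ F := by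
      intro d hdc
      obtain ⟨F', hF', hd⟩ := G.exists_isBicomponent_mem d
      by_contra hdF
      exact hincomp F' F hF' hF (fun h => hdF (h ▸ hd)) d hd c hc hdc
    exact ih F hF (a := ⟨a, hmem a hac⟩) (b := ⟨b, hmem b hbc⟩) (c := ⟨c, hc⟩) hac hbc

theorem upInd_of_le {e a : Γ.E} (h : p e a) : Γ.upInd p e a = 1 := if_pos h

theorem upInd_of_not_le {e a : Γ.E} (h : ¬ p e a) : Γ.upInd p e a = 0 := if_neg h

theorem upInd_nonneg (e a : Γ.E) : 0 ≤ Γ.upInd p e a := by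
  unfold upInd; split_ifs <;> norm_num

theorem upInd_mono (htrans : ∀ ⦃a b c⦄, p a b → p b c → p a c) (e : Γ.E) {a b : Γ.E}
    (hab : p a b) : Γ.upInd p e a ≤ Γ.upInd p e b := by
  by_cases h : p e a
  · rw [upInd_of_le h, upInd_of_le (htrans h hab)]
  · rw [upInd_of_not_le h]
    exact upInd_nonneg e b

/-- The cone of nonnegative functions on the edges that are monotone for `p`. -/
def monotoneCone (Γ : Multigraph) (p : Γ.E → Γ.E → Prop) : Set (Γ.E → ℝ) :=
  {x | (∀ e, 0 ≤ x e) ∧ ∀ e e', p e e' → x e ≤ x e'}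

theorem isClosed_monotoneCone : IsClosed (Γ.monotoneCone p) := by
  simp only [monotoneCone, Set.ofPred_and, Set.ofPred_forall]
  refine (isClosed_iInter fun e => ?_).inter
    (isClosed_iInter fun e => isClosed_iInter fun e' => isClosed_iInter fun _ => ?_)
  · exact isClosed_le continuous_const (continuous_apply e)
  · exact isClosed_le (continuous_apply e) (continuous_apply e')

theorem K_nonempty (hrefl : ∀ e, p e e) (htrans : ∀ ⦃a b c⦄, p a b → p b c → p a c) :
    (Γ.K p).Nonempty := by
  have hpos : ∀ e, 0 < {a | p a e}.ncard := fun e =>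
    (Set.ncard_pos (Set.toFinite _)).2 ⟨e, hrefl e⟩
  refine ⟨fun e => ({a | p a e}.ncard : ℝ), fun e => Nat.cast_pos.2 (hpos e),
    fun e e' hee' => ?_⟩
  have hsub : {a | p a e} ⊆ {a | p a e'} := fun a (ha : p a _) => htrans ha hee'
  refine ⟨Nat.cast_le.2 (Set.ncard_le_ncard hsub (Set.toFinite _)), fun heq => ?_, fun h => ?_⟩
  · have : {a | p a e} = {a | p a e'} :=
      Set.eq_of_subset_of_ncard_le hsub (Nat.cast_le.1 heq.ge) (Set.toFinite _)
    exact this.ge (hrefl e')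
  · have : {a | p a e} = {a | p a e'} := hsub.antisymm fun a (ha : p a _) => htrans ha h
    simp only [this]

theorem add_smul_mem_K {x y : Γ.E → ℝ} (hx : x ∈ Γ.monotoneCone p) (hy : y ∈ Γ.K p) {t : ℝ}
    (ht : 0 < t) : x + t • y ∈ Γ.K p := by
  refine ⟨fun e => add_pos_of_nonneg_of_pos (hx.1 e) (mul_pos ht (hy.1 e)), fun e e' h => ?_⟩
  have hxe := hx.2 e e' h
  have hye := mul_le_mul_of_nonneg_left (hy.2 e e' h).1 ht.le
  simp only [Pi.add_apply, Pi.smul_apply, smul_eq_mul]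
  refine ⟨add_le_add hxe hye, fun heq => ?_, fun h' => ?_⟩
  · exact (hy.2 e e' h).2.1 (mul_left_cancel₀ ht.ne' (by linarith))
  · rw [hxe.antisymm (hx.2 e' e h'), (hy.2 e e' h).2.2 h']

theorem closure_K (hrefl : ∀ e, p e e) (htrans : ∀ ⦃a b c⦄, p a b → p b c → p a c) :
    closure (Γ.K p) = Γ.monotoneCone p := by
  have hsub : Γ.K p ⊆ Γ.monotoneCone p := fun x hx =>
    ⟨fun e => (hx.1 e).le, fun e e' h => (hx.2 e e' h).1⟩
  refine (closure_minimal hsub isClosed_monotoneCone).antisymm fun x hx => ?_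
  obtain ⟨y, hy⟩ := K_nonempty hrefl htrans
  have hlim : Filter.Tendsto (fun t : ℝ => x + t • y) (nhdsWithin 0 (Set.Ioi 0)) (nhds x) := by
    have hcont : Continuous fun t : ℝ => x + t • y := by fun_prop
    simpa using (hcont.tendsto 0).mono_left nhdsWithin_le_nhds
  exact mem_closure_of_tendsto hlim
    (eventually_nhdsWithin_of_forall fun t ht => add_smul_mem_K hx hy ht)

theorem upInd_mem_monotoneCone (htrans : ∀ ⦃a b c⦄, p a b → p b c → p a c) (e : Γ.E) :
    Γ.upInd p e ∈ Γ.monotoneCone p :=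
  ⟨upInd_nonneg e, fun _ _ h => upInd_mono htrans e h⟩

theorem exists_minimal_support (htrans : ∀ ⦃a b c⦄, p a b → p b c → p a c)
    {x : Γ.E → ℝ} (hx : x ≠ 0) :
    ∃ e, x e ≠ 0 ∧ ∀ a, p a e → x a ≠ 0 → p e a := by
  let r : Γ.E → Γ.E → Prop := Γ.StrictBelow p
  have : IsTrans Γ.E r := ⟨fun a b c hab hbc => ⟨htrans hab.1 hbc.1, fun hca =>
    hab.2 (htrans hbc.1 hca)⟩⟩
  have : Std.Irrefl r := ⟨fun a h => h.2 h.1⟩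
  obtain ⟨e, he, hmin⟩ := (Finite.wellFounded_of_trans_of_irrefl r).has_min {e | x e ≠ 0}
    (Function.ne_iff.1 hx)
  exact ⟨e, he, fun a hae ha => by_contra fun hea => hmin a ha ⟨hae, hea⟩⟩

/-- The upper set generated by a minimal edge of the support of `x` can be peeled off `x`. -/
theorem sub_smul_upInd_mem_monotoneCone (htrans : ∀ ⦃a b c⦄, p a b → p b c → p a c)
    (hcomp : ∀ ⦃a b c⦄, p a c → p b c → p a b ∨ p b a) {x : Γ.E → ℝ}
    (hx : x ∈ Γ.monotoneCone p) {e : Γ.E} (hmin : ∀ a, p a e → x a ≠ 0 → p e a) :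
    x - x e • Γ.upInd p e ∈ Γ.monotoneCone p := by
  refine ⟨fun a => ?_, fun a b hab => ?_⟩ <;>
    simp only [Pi.sub_apply, Pi.smul_apply, smul_eq_mul]
  · by_cases ha : p e a
    · simpa [upInd_of_le ha] using hx.2 e a ha
    · simpa [upInd_of_not_le ha] using hx.1 a
  · by_cases ha : p e a
    · simpa [upInd_of_le ha, upInd_of_le (htrans ha hab)] using hx.2 a b hab
    by_cases hb : p e b
    · have hae : p a e := (hcomp hab hb).resolve_right ha
      have : x a = 0 := by_contra fun h => ha (hmin a hae h)
      simpa [upInd_of_not_le ha, upInd_of_le hb, this] using hx.2 e b hb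
    · simpa [upInd_of_not_le ha, upInd_of_not_le hb] using hx.2 a b hab

theorem exists_nonneg_sum_of_mem_monotoneCone [Fintype Γ.E] (hrefl : ∀ e, p e e)
    (htrans : ∀ ⦃a b c⦄, p a b → p b c → p a c)
    (hcomp : ∀ ⦃a b c⦄, p a c → p b c → p a b ∨ p b a) {x : Γ.E → ℝ}
    (hx : x ∈ Γ.monotoneCone p) :
    ∃ c : Γ.E → ℝ, (∀ e, 0 ≤ c e) ∧ x = ∑ e, c e • Γ.upInd p e := by
  classical
  induction hn : (Function.support x).ncard using Nat.strong_induction_on generalizing x with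
  | _ n ih =>
  by_cases h0 : x = 0
  · exact ⟨0, fun _ => le_rfl, by simp [h0]⟩
  obtain ⟨e, he, hmin⟩ := exists_minimal_support htrans h0
  have hsupp : Function.support (x - x e • Γ.upInd p e) ⊂ Function.support x := by
    refine (Set.ssubset_iff_of_subset fun a ha => ?_).2 ⟨e, he, ?_⟩
    · rw [Function.mem_support] at ha ⊢
      contrapose! ha
      have hea : ¬ p e a := fun hea => he (le_antisymm (ha ▸ hx.2 e a hea) (hx.1 e))
      simp [ha, upInd_of_not_le hea]
    · rw [Function.notMem_support]
      simp [upInd_of_le (hrefl e)]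
  obtain ⟨c, hc, hsum⟩ := ih _ (hn ▸ Set.ncard_lt_ncard hsupp (Set.toFinite _))
    (sub_smul_upInd_mem_monotoneCone htrans hcomp hx hmin) rfl
  refine ⟨c + Pi.single e (x e), fun a => add_nonneg (hc a) ?_, ?_⟩
  · exact (Pi.single_nonneg.2 (hx.1 e) : (0 : Γ.E → ℝ) ≤ _) a
  · simp only [Pi.add_apply, add_smul, Finset.sum_add_distrib, ← hsum]
    rw [Finset.sum_eq_single e (fun b _ hb => by simp [hb]) (by simp)]
    simp

theorem sum_smul_upInd_mem_monotoneCone [Fintype Γ.E]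
    (htrans : ∀ ⦃a b c⦄, p a b → p b c → p a c) {c : Γ.E → ℝ} (hc : ∀ e, 0 ≤ c e) :
    ∑ e, c e • Γ.upInd p e ∈ Γ.monotoneCone p := by
  refine ⟨fun a => ?_, fun a b hab => ?_⟩ <;>
    simp only [Finset.sum_apply, Pi.smul_apply, smul_eq_mul]
  · exact Finset.sum_nonneg fun e _ => mul_nonneg (hc e) (upInd_nonneg e a)
  · exact Finset.sum_le_sum fun e _ =>
      mul_le_mul_of_nonneg_left (upInd_mono htrans e hab) (hc e)

/-- The ray spanned by the indicator vector of the upper set generated by `e`. -/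
def upRay (Γ : Multigraph) (p : Γ.E → Γ.E → Prop) (e : Γ.E) : Set (Γ.E → ℝ) :=
  {x | ∃ t : ℝ, 0 ≤ t ∧ x = t • Γ.upInd p e}

theorem smul_upInd_mem_monotoneCone (htrans : ∀ ⦃a b c⦄, p a b → p b c → p a c) (e : Γ.E)
    {t : ℝ} (ht : 0 ≤ t) : t • Γ.upInd p e ∈ Γ.monotoneCone p :=
  ⟨fun a => mul_nonneg ht (upInd_nonneg e a), fun _ _ h =>
    mul_le_mul_of_nonneg_left (upInd_mono htrans e h) ht⟩

theorem isFaceOf_upRay (hrefl : ∀ e, p e e) (htrans : ∀ ⦃a b c⦄, p a b → p b c → p a c)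
    (e : Γ.E) : IsFaceOf (Γ.monotoneCone p) (Γ.upRay p e) := by
  have := Fintype.ofFinite Γ.E
  let ℓ : (Γ.E → ℝ) →ₗ[ℝ] ℝ := ∑ a, (LinearMap.proj a - Γ.upInd p e a • LinearMap.proj e)
  have hℓ : ∀ x, ℓ x = ∑ a, (x a - Γ.upInd p e a * x e) := fun x => by
    simp [ℓ, LinearMap.sum_apply]
  have hterm : ∀ x ∈ Γ.monotoneCone p, ∀ a, 0 ≤ x a - Γ.upInd p e a * x e := fun x hx a => by
    by_cases ha : p e a
    · simpa [upInd_of_le ha] using hx.2 e a ha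
    · simpa [upInd_of_not_le ha] using hx.1 a
  refine Or.inr ⟨ℓ, fun x hx => ?_, Set.ext fun x => ⟨?_, ?_⟩⟩
  · rw [hℓ]
    exact Finset.sum_nonneg fun a _ => hterm x hx a
  · rintro ⟨t, ht, rfl⟩
    refine ⟨smul_upInd_mem_monotoneCone htrans e ht, ?_⟩
    simp [hℓ, upInd_of_le (hrefl e), mul_comm]
  · rintro ⟨hx, hx0 : ℓ x = 0⟩
    rw [hℓ, Finset.sum_eq_zero_iff_of_nonneg fun a _ => hterm x hx a] at hx0
    refine ⟨x e, hx.1 e, funext fun a => ?_⟩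
    have := hx0 a (Finset.mem_univ a)
    simp only [Pi.smul_apply, smul_eq_mul]
    linarith

theorem upInd_ne_zero (hrefl : ∀ e, p e e) (e : Γ.E) : Γ.upInd p e ≠ 0 := fun h => by
  simpa [upInd_of_le (hrefl e)] using congrFun h e

theorem finrank_span_upRay (hrefl : ∀ e, p e e) (e : Γ.E) :
    Module.finrank ℝ (Submodule.span ℝ (Γ.upRay p e)) = 1 := by
  have hspan : Submodule.span ℝ (Γ.upRay p e) = ℝ ∙ Γ.upInd p e := by
    refine le_antisymm (Submodule.span_le.2 ?_)
      (Submodule.span_mono (Set.singleton_subset_iff.2 ⟨1, zero_le_one, (one_smul _ _).symm⟩))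
    rintro _ ⟨t, -, rfl⟩
    exact Submodule.smul_mem _ t (Submodule.mem_span_singleton_self _)
  rw [hspan, finrank_span_singleton (upInd_ne_zero hrefl e)]

theorem exists_eq_upRay_of_finrank_span_eq_one (hrefl : ∀ e, p e e)
    (htrans : ∀ ⦃a b c⦄, p a b → p b c → p a c)
    (hcomp : ∀ ⦃a b c⦄, p a c → p b c → p a b ∨ p b a) {F : Set (Γ.E → ℝ)}
    (hF : IsFaceOf (Γ.monotoneCone p) F) (hdim : Module.finrank ℝ (Submodule.span ℝ F) = 1) :
    ∃ e, F = Γ.upRay p e := by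
  have := Fintype.ofFinite Γ.E
  obtain ⟨ℓ, hℓ, rfl⟩ : ∃ ℓ : (Γ.E → ℝ) →ₗ[ℝ] ℝ, (∀ x ∈ Γ.monotoneCone p, 0 ≤ ℓ x) ∧
      F = Γ.monotoneCone p ∩ {x | ℓ x = 0} := by
    rcases hF with rfl | hF
    · exact ⟨0, by simp, by simp⟩
    · exact hF
  obtain ⟨x, ⟨hx, hx0 : ℓ x = 0⟩, hne⟩ : ∃ x ∈ Γ.monotoneCone p ∩ {x | ℓ x = 0}, x ≠ 0 := by
    by_contra! h
    rw [Submodule.span_eq_bot.2 h, finrank_bot] at hdim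
    exact zero_ne_one hdim
  obtain ⟨c, hc, rfl⟩ := exists_nonneg_sum_of_mem_monotoneCone hrefl htrans hcomp hx
  obtain ⟨e, -, he⟩ := Finset.exists_ne_zero_of_sum_ne_zero hne
  have hℓe : ℓ (Γ.upInd p e) = 0 := by
    simp only [map_sum, map_smul, smul_eq_mul] at hx0
    rw [Finset.sum_eq_zero_iff_of_nonneg fun a _ =>
      mul_nonneg (hc a) (hℓ _ (upInd_mem_monotoneCone htrans a))] at hx0
    exact (mul_eq_zero.1 (hx0 e (Finset.mem_univ e))).resolve_left (left_ne_zero_of_smul he)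
  have hmem : Γ.upInd p e ∈ Γ.monotoneCone p ∩ {x | ℓ x = 0} :=
    ⟨upInd_mem_monotoneCone htrans e, hℓe⟩
  refine ⟨e, Set.ext fun y => ⟨fun hy => ?_, ?_⟩⟩
  · obtain ⟨t, ht⟩ := (finrank_eq_one_iff_of_nonzero'
      (⟨Γ.upInd p e, Submodule.subset_span hmem⟩ : Submodule.span ℝ _)
      (fun h => upInd_ne_zero hrefl e (congrArg Subtype.val h))).1 hdim
      ⟨y, Submodule.subset_span hy⟩
    obtain rfl : t • Γ.upInd p e = y := congrArg Subtype.val ht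
    refine ⟨t, ?_, rfl⟩
    simpa [upInd_of_le (hrefl e)] using hy.1.1 e
  · rintro ⟨t, ht, rfl⟩
    exact ⟨smul_upInd_mem_monotoneCone htrans e ht, by simp [hℓe]⟩

end Multigraph

/-- Proposition 3.21: the closure of `K(Γ, p)` is the set of
nonnegative linear combinations of the indicator vectors `v_T` of the irreducible upper
sets `T`, and the rays spanned by the `v_T` are exactly the one-dimensional faces of this
closed cone. -/
theorem ray_generators_of_closure_K (Γ : Multigraph) (p : Γ.E → Γ.E → Prop)
    (h : Multigraph.IsEnriched Γ p) :
    (closure (Multigraph.K Γ p) =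
      {x : Γ.E → ℝ | ∃ c : Γ.E → ℝ, (∀ e : Γ.E, 0 ≤ c e) ∧
        x = ∑ᶠ e : Γ.E, c e • Multigraph.upInd Γ p e}) ∧
    (∀ e : Γ.E,
      IsFaceOf (closure (Multigraph.K Γ p))
        {x : Γ.E → ℝ | ∃ t : ℝ, 0 ≤ t ∧ x = t • Multigraph.upInd Γ p e} ∧
      Module.finrank ℝ
        ↥(Submodule.span ℝ
          {x : Γ.E → ℝ | ∃ t : ℝ, 0 ≤ t ∧ x = t • Multigraph.upInd Γ p e}) = 1) ∧
    (∀ F : Set (Γ.E → ℝ), IsFaceOf (closure (Multigraph.K Γ p)) F →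
      Module.finrank ℝ ↥(Submodule.span ℝ F) = 1 →
      ∃ e : Γ.E, F = {x : Γ.E → ℝ | ∃ t : ℝ, 0 ≤ t ∧ x = t • Multigraph.upInd Γ p e}) := by
  have := Fintype.ofFinite Γ.E
  have hrefl := h.refl_s16
  rw [Multigraph.closure_K hrefl h.trans_s16]
  refine ⟨Set.ext fun x => ?_, fun e => ⟨Multigraph.isFaceOf_upRay hrefl h.trans_s16 e,
    Multigraph.finrank_span_upRay hrefl e⟩, fun F hF hdim =>
    Multigraph.exists_eq_upRay_of_finrank_span_eq_one hrefl h.trans_s16 h.comparable_of_le hF hdim⟩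
  simp only [finsum_eq_sum_of_fintype, Set.mem_ofPred_eq]
  refine ⟨Multigraph.exists_nonneg_sum_of_mem_monotoneCone hrefl h.trans_s16 h.comparable_of_le, ?_⟩
  rintro ⟨c, hc, rfl⟩
  exact Multigraph.sum_smul_upInd_mem_monotoneCone h.trans_s16 hc
end
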